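/- arXiv:2512.08775 — 3 statements merged into one kernel-verified Lean document; each statement's English description precedes it below -/
import Mathlib

section
/- Let f : ℝⁿ → ℝ be twice continuously differentiable with L₂-Lipschitz Hessian, and let ρ : ℝⁿ → ℝ be differentiable with L_V-Lipschitz gradient. Fix a point x_k with ∇f(x_k) ≠ 0, a symmetric matrix H_k, constants A_k ≥ 0, r_k > 0, and suppose d ∈ ℝⁿ satisfies H_k d + A_k(∇ρ(x_k + d) − ∇ρ(x_k)) = −∇f(x_k) and ‖d‖ ≤ r_k‖∇f(x_k)‖^{1/2}. Then ‖∇f(x_k + d)‖ ≤ ( (L₂/2)r_k² + L_V A_k r_k/‖∇f(x_k)‖^{1/2} + ‖∇²f(x_k) − H_k‖·r_k/‖∇f(x_k)‖^{1/2} )·‖∇f(x_k)‖. -/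
open RealInnerProductSpace

/-- First-order Taylor bound for a map with Lipschitz derivative. -/
lemma norm_taylor_remainder_le_of_lipschitz_fderiv {E F : Type*}
    [NormedAddCommGroup E] [NormedSpace ℝ E] [NormedAddCommGroup F] [NormedSpace ℝ F]
    {g : E → F} {L : ℝ} (hg : Differentiable ℝ g)
    (hL : ∀ x y, ‖fderiv ℝ g x - fderiv ℝ g y‖ ≤ L * ‖x - y‖) (x d : E) :
    ‖g (x + d) - g x - fderiv ℝ g x d‖ ≤ L / 2 * ‖d‖ ^ 2 := by
  have hline (t : ℝ) : HasDerivAt (fun t : ℝ => x + t • d) d t := by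
    simpa using ((hasDerivAt_id t).smul_const d).const_add x
  have hφ (t : ℝ) : HasDerivAt (fun t : ℝ => g (x + t • d) - g x - t • fderiv ℝ g x d)
      (fderiv ℝ g (x + t • d) d - fderiv ℝ g x d) t := by
    have h := ((hg (x + t • d)).hasFDerivAt.comp_hasDerivAt t (hline t)).sub_const (g x)
    have h' := h.sub ((hasDerivAt_id t).smul_const (fderiv ℝ g x d))
    rw [one_smul] at h'
    exact h'
  have hB (t : ℝ) : HasDerivAt (fun t : ℝ => L / 2 * ‖d‖ ^ 2 * t ^ 2) (L * ‖d‖ ^ 2 * t) t := by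
    refine ((hasDerivAt_pow 2 t).const_mul (L / 2 * ‖d‖ ^ 2)).congr_deriv ?_
    norm_num
    ring
  have key := image_norm_le_of_norm_deriv_right_le_deriv_boundary (a := 0) (b := 1)
    (fun t _ => (hφ t).continuousAt.continuousWithinAt) (fun t _ => (hφ t).hasDerivWithinAt)
    (by simp) hB (fun t ht => ?_) (Set.right_mem_Icc.2 zero_le_one)
  · simpa using key
  · calc ‖fderiv ℝ g (x + t • d) d - fderiv ℝ g x d‖
        = ‖(fderiv ℝ g (x + t • d) - fderiv ℝ g x) d‖ := by simp
      _ ≤ ‖fderiv ℝ g (x + t • d) - fderiv ℝ g x‖ * ‖d‖ := ContinuousLinearMap.le_opNorm _ _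
      _ ≤ L * ‖x + t • d - x‖ * ‖d‖ := by gcongr; exact hL _ _
      _ = L * ‖d‖ ^ 2 * t := by
        rw [add_sub_cancel_left, norm_smul, Real.norm_of_nonneg ht.1]
        ring

/-- The gradient of a `C²` function is differentiable. -/
lemma ContDiff.differentiable_gradient {E : Type*} [NormedAddCommGroup E]
    [InnerProductSpace ℝ E] [CompleteSpace E] {f : E → ℝ} (hf : ContDiff ℝ 2 f) :
    Differentiable ℝ (gradient f) :=
  (InnerProductSpace.toDual ℝ E).symm.toContinuousLinearEquiv.differentiable.comp
    ((hf.fderiv_right (m := 1) (by norm_num)).differentiable (by norm_num))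

/-- Gradient-norm bound when the trust-region constraint is inactive
(Lagrange multiplier `λ = 0`). -/
theorem stmt4 {n : ℕ} (f ρ : EuclideanSpace ℝ (Fin n) → ℝ) (L₂ LV : ℝ)
    (hf : ContDiff ℝ 2 f)
    (hfLip : ∀ x y, ‖fderiv ℝ (gradient f) x - fderiv ℝ (gradient f) y‖ ≤ L₂ * ‖x - y‖)
    (hρ : Differentiable ℝ ρ)
    (hρlip : ∀ x y, ‖gradient ρ y - gradient ρ x‖ ≤ LV * ‖y - x‖)
    (xk : EuclideanSpace ℝ (Fin n)) (hxk : gradient f xk ≠ 0)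
    (Hk : EuclideanSpace ℝ (Fin n) →L[ℝ] EuclideanSpace ℝ (Fin n))
    (hHsym : ∀ u v, ⟪Hk u, v⟫ = ⟪u, Hk v⟫)
    (Ak rk : ℝ) (hAk : 0 ≤ Ak) (hrk : 0 < rk)
    (d : EuclideanSpace ℝ (Fin n))
    (hstat : Hk d + Ak • (gradient ρ (xk + d) - gradient ρ xk) = -gradient f xk)
    (hd : ‖d‖ ≤ rk * Real.sqrt ‖gradient f xk‖) :
    ‖gradient f (xk + d)‖ ≤
      (L₂ / 2 * rk ^ 2 + LV * Ak * rk / Real.sqrt ‖gradient f xk‖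
          + ‖fderiv ℝ (gradient f) xk - Hk‖ * rk / Real.sqrt ‖gradient f xk‖)
        * ‖gradient f xk‖ := by
  have hpos : 0 < ‖gradient f xk‖ := norm_pos_iff.2 hxk
  have hL₂ : 0 ≤ L₂ := by
    have h := (norm_nonneg _).trans (hfLip (gradient f xk) 0)
    rw [sub_zero] at h
    exact nonneg_of_mul_nonneg_left h hpos
  have hLV : 0 ≤ LV := by
    have h := (norm_nonneg _).trans (hρlip 0 (gradient f xk))
    rw [sub_zero] at h
    exact nonneg_of_mul_nonneg_left h hpos
  have htaylor :=
    norm_taylor_remainder_le_of_lipschitz_fderiv hf.differentiable_gradient hfLip xk d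
  have hρd : ‖gradient ρ (xk + d) - gradient ρ xk‖ ≤ LV * ‖d‖ := by
    simpa using hρlip xk (xk + d)
  have hsplit : gradient f (xk + d) =
      (gradient f (xk + d) - gradient f xk - fderiv ℝ (gradient f) xk d)
        + (fderiv ℝ (gradient f) xk - Hk) d
        - Ak • (gradient ρ (xk + d) - gradient ρ xk) := by
    rw [eq_neg_iff_add_eq_zero] at hstat
    rw [← sub_eq_zero, ← hstat, sub_apply]
    abel
  set s := Real.sqrt ‖gradient f xk‖
  have hs : 0 < s := Real.sqrt_pos.2 hpos
  have hss : ‖gradient f xk‖ = s ^ 2 := (Real.sq_sqrt hpos.le).symm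
  calc ‖gradient f (xk + d)‖
      ≤ ‖gradient f (xk + d) - gradient f xk - fderiv ℝ (gradient f) xk d‖
        + ‖(fderiv ℝ (gradient f) xk - Hk) d‖
        + ‖Ak • (gradient ρ (xk + d) - gradient ρ xk)‖ := by
        conv_lhs => rw [hsplit]
        exact (norm_sub_le _ _).trans (by gcongr; exact norm_add_le _ _)
    _ ≤ L₂ / 2 * ‖d‖ ^ 2 + ‖fderiv ℝ (gradient f) xk - Hk‖ * ‖d‖ + Ak * (LV * ‖d‖) := by
        rw [norm_smul, Real.norm_of_nonneg hAk]
        gcongr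
        exact ContinuousLinearMap.le_opNorm _ _
    _ ≤ L₂ / 2 * (rk * s) ^ 2 + ‖fderiv ℝ (gradient f) xk - Hk‖ * (rk * s)
        + Ak * (LV * (rk * s)) := by gcongr
    _ = _ := by
        rw [hss]
        field_simp
        ring
end

section
/- Let f : ℝⁿ → ℝ be twice continuously differentiable with L₂-Lipschitz Hessian, and let ρ : ℝⁿ → ℝ be twice continuously differentiable, σ_V-strongly convex, with L_V-Lipschitz gradient, where 2σ_V > L_V. Fix η > 0, a point x_k with ∇f(x_k) ≠ 0, a symmetric matrix H_k, r_k > 0, and set A_k = ‖∇²f(x_k) − H_k‖/(2σ_V − L_V) + (r_k‖∇f(x_k)‖^{1/2}/(2σ_V − L_V))·(2η + L₂/3). Suppose d ∈ ℝⁿ and λ ≥ 0 satisfy: (i) H_k d + λd + A_k(∇ρ(x_k + d) − ∇ρ(x_k)) = −∇f(x_k); (ii) H_k + A_k∇²ρ(x_k + d) + λI is positive semidefinite; (iii) ‖d‖ ≤ r_k‖∇f(x_k)‖^{1/2}. Then f(x_k + d) ≤ f(x_k) − (λ/2)‖d‖² − η‖d‖³; in particular f(x_k + d) ≤ f(x_k).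 -/
open RealInnerProductSpace

open Set in
/-- A function vanishing at `0` whose derivative is nonnegative on `[0, ∞)` is nonnegative there. -/
theorem nonneg_of_hasDerivAt_nonneg {φ φ' : ℝ → ℝ} (h : ∀ t, HasDerivAt φ (φ' t) t)
    (h0 : φ 0 = 0) (h' : ∀ t, 0 ≤ t → 0 ≤ φ' t) {t : ℝ} (ht : 0 ≤ t) : 0 ≤ φ t := by
  have hmono : MonotoneOn φ (Ici 0) := by
    refine monotoneOn_of_hasDerivWithinAt_nonneg (convex_Ici 0)
      (fun s _ => (h s).continuousAt.continuousWithinAt)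
      (fun s _ => (h s).hasDerivWithinAt) fun s hs => h' s ?_
    rw [interior_Ici] at hs
    exact le_of_lt hs
  simpa [h0] using hmono (mem_Ici.2 le_rfl) (mem_Ici.2 ht) ht

section Gradient

variable {F : Type*} [NormedAddCommGroup F] [InnerProductSpace ℝ F] [CompleteSpace F]

theorem ContDiff.differentiable_gradient_s6 {f : F → ℝ} (hf : ContDiff ℝ 2 f) :
    Differentiable ℝ (gradient f) := by
  have h : ContDiff ℝ 1 (fderiv ℝ f) := hf.fderiv_right (by norm_num)
  exact (InnerProductSpace.toDual ℝ F).symm.toContinuousLinearEquiv.differentiable.comp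
    (h.differentiable (by norm_num))

/-- Cubic upper bound for a function with Lipschitz Hessian. -/
theorem ContDiff.le_taylor_of_lipschitz_hessian {f : F → ℝ} (hf : ContDiff ℝ 2 f) {L : ℝ}
    (hL : ∀ x y, ‖fderiv ℝ (gradient f) x - fderiv ℝ (gradient f) y‖ ≤ L * ‖x - y‖) (x d : F) :
    f (x + d) ≤ f x + ⟪gradient f x, d⟫ + 1 / 2 * ⟪fderiv ℝ (gradient f) x d, d⟫
      + L / 6 * ‖d‖ ^ 3 := by
  have hline (t : ℝ) : HasDerivAt (fun t : ℝ => x + t • d) d t := by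
    simpa using ((hasDerivAt_id t).smul_const d).const_add x
  have h1 (t : ℝ) : HasDerivAt (fun t : ℝ => f (x + t • d)) ⟪gradient f (x + t • d), d⟫ t := by
    have := ((hf.differentiable (by norm_num)) (x + t • d)).hasGradientAt.hasFDerivAt
    exact (this.comp_hasDerivAt t (hline t)).congr_deriv (by simp)
  have h2 (t : ℝ) : HasDerivAt (fun t : ℝ => ⟪gradient f (x + t • d), d⟫)
      ⟪fderiv ℝ (gradient f) (x + t • d) d, d⟫ t := by
    have := (hf.differentiable_gradient_s6 (x + t • d)).hasFDerivAt.comp_hasDerivAt t (hline t)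
    simpa using this.inner ℝ (hasDerivAt_const t d)
  have hbound (t : ℝ) (ht : 0 ≤ t) : 0 ≤ ⟪fderiv ℝ (gradient f) x d, d⟫ + L * ‖d‖ ^ 3 * t
      - ⟪fderiv ℝ (gradient f) (x + t • d) d, d⟫ := by
    have hx : ‖fderiv ℝ (gradient f) (x + t • d) - fderiv ℝ (gradient f) x‖ ≤ L * (t * ‖d‖) := by
      simpa [norm_smul, abs_of_nonneg ht] using hL (x + t • d) x
    have := calc
      ⟪(fderiv ℝ (gradient f) (x + t • d) - fderiv ℝ (gradient f) x) d, d⟫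
        ≤ ‖(fderiv ℝ (gradient f) (x + t • d) - fderiv ℝ (gradient f) x) d‖ * ‖d‖ :=
          real_inner_le_norm _ _
      _ ≤ (L * (t * ‖d‖)) * ‖d‖ * ‖d‖ := by
          gcongr
          exact ContinuousLinearMap.le_of_opNorm_le _ hx d
    rw [sub_apply, inner_sub_left] at this
    linarith
  have hid (t : ℝ) := hasDerivAt_id' t
  have hfirst (t : ℝ) (ht : 0 ≤ t) :
      0 ≤ ⟪gradient f x, d⟫ + t * ⟪fderiv ℝ (gradient f) x d, d⟫ + L * ‖d‖ ^ 3 / 2 * t ^ 2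
        - ⟪gradient f (x + t • d), d⟫ := by
    refine nonneg_of_hasDerivAt_nonneg (φ := fun t => ⟪gradient f x, d⟫
      + t * ⟪fderiv ℝ (gradient f) x d, d⟫ + L * ‖d‖ ^ 3 / 2 * t ^ 2
      - ⟪gradient f (x + t • d), d⟫) (fun s => ?_) (by simp) hbound ht
    refine ((((hid s).mul_const _).const_add _).add (((hid s).pow 2).const_mul _)).sub (h2 s)
      |>.congr_deriv ?_
    push_cast
    ring
  have hzero : 0 ≤ f x + 1 * ⟪gradient f x, d⟫ + 1 / 2 * ⟪fderiv ℝ (gradient f) x d, d⟫ * 1 ^ 2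
      + L / 6 * ‖d‖ ^ 3 * 1 ^ 3 - f (x + (1 : ℝ) • d) := by
    refine nonneg_of_hasDerivAt_nonneg (φ := fun t => f x + t * ⟪gradient f x, d⟫
      + 1 / 2 * ⟪fderiv ℝ (gradient f) x d, d⟫ * t ^ 2
      + L / 6 * ‖d‖ ^ 3 * t ^ 3 - f (x + t • d)) (fun s => ?_) (by simp) hfirst zero_le_one
    refine (((((hid s).mul_const _).const_add _).add (((hid s).pow 2).const_mul _)).add
      (((hid s).pow 3).const_mul _)).sub (h1 s) |>.congr_deriv ?_
    push_cast
    ring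
  rw [one_smul] at hzero
  linarith

end Gradient

/-- Monotone decrease of the HAT method: with the prescribed choice of `A_k`,
any KKT point `d` of the trust-region subproblem satisfies
`f(x_k + d) ≤ f(x_k) − (λ/2)‖d‖² − η‖d‖³`, in particular `f(x_k + d) ≤ f(x_k)`. -/
theorem stmt6 {n : ℕ} (f ρ : EuclideanSpace ℝ (Fin n) → ℝ) (L₂ σV LV η : ℝ)
    (hf : ContDiff ℝ 2 f)
    (hfLip : ∀ x y, ‖fderiv ℝ (gradient f) x - fderiv ℝ (gradient f) y‖ ≤ L₂ * ‖x - y‖)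
    (hρ : ContDiff ℝ 2 ρ)
    (hsc : ∀ x y, ρ y ≥ ρ x + ⟪gradient ρ x, y - x⟫ + σV / 2 * ‖y - x‖ ^ 2)
    (hρlip : ∀ x y, ‖gradient ρ y - gradient ρ x‖ ≤ LV * ‖y - x‖)
    (hσL : LV < 2 * σV) (hη : 0 < η)
    (xk : EuclideanSpace ℝ (Fin n)) (hxk : gradient f xk ≠ 0)
    (Hk : EuclideanSpace ℝ (Fin n) →L[ℝ] EuclideanSpace ℝ (Fin n))
    (hHsym : ∀ u v, ⟪Hk u, v⟫ = ⟪u, Hk v⟫)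
    (rk Ak : ℝ) (hrk : 0 < rk)
    (hAk : Ak = ‖fderiv ℝ (gradient f) xk - Hk‖ / (2 * σV - LV)
        + rk * Real.sqrt ‖gradient f xk‖ / (2 * σV - LV) * (2 * η + L₂ / 3))
    (d : EuclideanSpace ℝ (Fin n)) (lam : ℝ) (hlam : 0 ≤ lam)
    (hKKT1 : Hk d + lam • d + Ak • (gradient ρ (xk + d) - gradient ρ xk) = -gradient f xk)
    (hKKT2 : ∀ v, 0 ≤ ⟪Hk v + Ak • (fderiv ℝ (gradient ρ) (xk + d)) v + lam • v, v⟫)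
    (hKKT3 : ‖d‖ ≤ rk * Real.sqrt ‖gradient f xk‖) :
    f (xk + d) ≤ f xk - lam / 2 * ‖d‖ ^ 2 - η * ‖d‖ ^ 3 ∧ f (xk + d) ≤ f xk := by
  have hu : 0 < ‖gradient f xk‖ := norm_pos_iff.2 hxk
  have hL₂ : 0 ≤ L₂ := by
    have h := (norm_nonneg _).trans (hfLip (gradient f xk) 0)
    rw [sub_zero] at h
    exact nonneg_of_mul_nonneg_left h hu
  have hLV : 0 ≤ LV := by
    have h := (norm_nonneg _).trans (hρlip 0 (gradient f xk))
    rw [sub_zero] at h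
    exact nonneg_of_mul_nonneg_left h hu
  have hgap : 0 < 2 * σV - LV := by linarith
  have hA : 0 ≤ Ak := by
    rw [hAk]
    positivity
  have hA_mul : Ak * (2 * σV - LV) = ‖fderiv ℝ (gradient f) xk - Hk‖
      + rk * Real.sqrt ‖gradient f xk‖ * (2 * η + L₂ / 3) := by
    rw [hAk]
    field_simp
  have htaylor := hf.le_taylor_of_lipschitz_hessian hfLip xk d
  have hmodel : ⟪fderiv ℝ (gradient f) xk d, d⟫ - ⟪Hk d, d⟫
      ≤ ‖fderiv ℝ (gradient f) xk - Hk‖ * ‖d‖ ^ 2 := by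
    rw [← inner_sub_left, ← sub_apply, pow_two, ← mul_assoc]
    refine (real_inner_le_norm _ _).trans ?_
    gcongr
    exact ContinuousLinearMap.le_opNorm _ _
  have hhess : ⟪fderiv ℝ (gradient ρ) (xk + d) d, d⟫ ≤ LV * ‖d‖ ^ 2 := by
    have hnorm : ‖fderiv ℝ (gradient ρ) (xk + d)‖ ≤ LV :=
      (hρ.differentiable_gradient_s6 (xk + d)).hasFDerivAt.le_of_lip' hLV
        (Filter.Eventually.of_forall fun y => hρlip (xk + d) y)
    rw [pow_two, ← mul_assoc]
    refine (real_inner_le_norm _ _).trans ?_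
    gcongr
    exact ContinuousLinearMap.le_of_opNorm_le _ hnorm d
  have hmono : σV * ‖d‖ ^ 2 ≤ ⟪gradient ρ (xk + d) - gradient ρ xk, d⟫ := by
    have ha := hsc xk (xk + d)
    have hb := hsc (xk + d) xk
    rw [add_sub_cancel_left] at ha
    rw [sub_add_cancel_left, inner_neg_right, norm_neg] at hb
    rw [inner_sub_left]
    linarith
  have hstat := congrArg (fun v => ⟪v, d⟫) hKKT1
  have hpsd := hKKT2 d
  simp only [inner_add_left, real_inner_smul_left, inner_neg_left,
    real_inner_self_eq_norm_sq] at hstat hpsd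
  have hcross : Ak * ⟪fderiv ℝ (gradient ρ) (xk + d) d, d⟫
      - 2 * (Ak * ⟪gradient ρ (xk + d) - gradient ρ xk, d⟫) ≤ -(Ak * (2 * σV - LV)) * ‖d‖ ^ 2 := by
    have ha := mul_le_mul_of_nonneg_left hhess hA
    have hb := mul_le_mul_of_nonneg_left hmono hA
    linarith
  rw [hA_mul] at hcross
  have hradius : ‖d‖ * ((2 * η + L₂ / 3) * ‖d‖ ^ 2)
      ≤ rk * Real.sqrt ‖gradient f xk‖ * ((2 * η + L₂ / 3) * ‖d‖ ^ 2) := by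
    gcongr
  have hdecrease : f (xk + d) ≤ f xk - lam / 2 * ‖d‖ ^ 2 - η * ‖d‖ ^ 3 := by
    linarith
  have hlam' : 0 ≤ lam / 2 * ‖d‖ ^ 2 := by positivity
  have hη' : 0 ≤ η * ‖d‖ ^ 3 := by positivity
  exact ⟨hdecrease, by linarith⟩
end

section
/- Let N ≥ 1, and for i = 1, …, N let φᵢ : ℝⁿ → ℝ be twice continuously differentiable with ‖∇²φᵢ(x)‖ ≤ L for all x ∈ ℝⁿ, and let bᵢ ∈ ℝ. Define the least-squares objective f(x) = (1/2)·Σᵢ₌₁ᴺ (φᵢ(x) − bᵢ)² and the Gauss–Newton matrix H(x) = Σᵢ₌₁ᴺ ∇φᵢ(x)∇φᵢ(x)ᵀ. Then for every x ∈ ℝⁿ, ‖∇²f(x) − H(x)‖ ≤ L·√(2N·f(x)). -/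
open RealInnerProductSpace

section GaussNewton

variable {E ι : Type*} [NormedAddCommGroup E] [InnerProductSpace ℝ E] [CompleteSpace E] [Fintype ι]

theorem ContDiff.differentiable_gradient_s13 {g : E → ℝ} (hg : ContDiff ℝ 2 g) :
    Differentiable ℝ (gradient g) :=
  (InnerProductSpace.toDual ℝ E).symm.toContinuousLinearEquiv.differentiable.comp
    ((hg.fderiv_right (m := 1) (by norm_num)).differentiable (by norm_num))

theorem hasGradientAt_half_sum_sq {φ : ι → E → ℝ} {x : E} (b : ι → ℝ)
    (hφ : ∀ i, DifferentiableAt ℝ (φ i) x) :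
    HasGradientAt (fun y => 1 / 2 * ∑ i, (φ i y - b i) ^ 2)
      (∑ i, (φ i x - b i) • gradient (φ i) x) x := by
  rw [hasGradientAt_iff_hasFDerivAt]
  have h := (HasFDerivAt.fun_sum (u := Finset.univ) fun i _ =>
    ((hφ i).hasGradientAt.hasFDerivAt.sub_const (b i)).pow 2).const_mul (1 / 2 : ℝ)
  refine h.congr_fderiv ?_
  ext v
  simp [Finset.mul_sum]
  refine Finset.sum_congr rfl fun i _ => ?_
  ring

theorem hasFDerivAt_sum_residual_smul_gradient {φ : ι → E → ℝ} (b : ι → ℝ)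
    (hφ : ∀ i, ContDiff ℝ 2 (φ i)) (x : E) :
    HasFDerivAt (fun y => ∑ i, (φ i y - b i) • gradient (φ i) y)
      (∑ i, ((φ i x - b i) • fderiv ℝ (gradient (φ i)) x +
        (InnerProductSpace.toDual ℝ E (gradient (φ i) x)).smulRight (gradient (φ i) x))) x :=
  HasFDerivAt.fun_sum fun i _ =>
    ((((hφ i).differentiable two_ne_zero x).hasGradientAt.hasFDerivAt.sub_const (b i)).smul
      ((hφ i).differentiable_gradient_s13 x).hasFDerivAt)

theorem sum_abs_le_sqrt_card_mul_sum_sq (r : ι → ℝ) :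
    ∑ i, |r i| ≤ √(Fintype.card ι * ∑ i, r i ^ 2) := by
  refine Real.le_sqrt_of_sq_le ?_
  simpa using sq_sum_le_card_mul_sum_sq (s := Finset.univ) (f := fun i => |r i|)

end GaussNewton

/-- Gauss–Newton approximation error for least-squares objectives:
`‖∇²f(x) − H(x)‖ ≤ L√(2N f(x))`. -/
theorem stmt13 {n : ℕ} (N : ℕ) (hN : 1 ≤ N) (L : ℝ)
    (φ : Fin N → EuclideanSpace ℝ (Fin n) → ℝ) (b : Fin N → ℝ)
    (hφ : ∀ i, ContDiff ℝ 2 (φ i))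
    (hHessφ : ∀ i x, ‖fderiv ℝ (gradient (φ i)) x‖ ≤ L)
    (f : EuclideanSpace ℝ (Fin n) → ℝ)
    (hfdef : ∀ x, f x = 1 / 2 * ∑ i, (φ i x - b i) ^ 2)
    (H : EuclideanSpace ℝ (Fin n) →
      EuclideanSpace ℝ (Fin n) →L[ℝ] EuclideanSpace ℝ (Fin n))
    (hHdef : ∀ x v, H x v = ∑ i, ⟪gradient (φ i) x, v⟫ • gradient (φ i) x) :
    ∀ x, ‖fderiv ℝ (gradient f) x - H x‖ ≤ L * Real.sqrt (2 * N * f x) := by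
  intro x
  have hL : 0 ≤ L := (norm_nonneg _).trans (hHessφ ⟨0, hN⟩ x)
  have hgrad : gradient f = fun y => ∑ i, (φ i y - b i) • gradient (φ i) y := by
    rw [funext hfdef]
    exact funext fun y =>
      (hasGradientAt_half_sum_sq b fun i => (hφ i).differentiable two_ne_zero y).gradient
  have hdiff : fderiv ℝ (gradient f) x - H x =
      ∑ i, (φ i x - b i) • fderiv ℝ (gradient (φ i)) x := by
    rw [hgrad, (hasFDerivAt_sum_residual_smul_gradient b hφ x).fderiv, sub_eq_iff_eq_add,
      Finset.sum_add_distrib]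
    congr 1
    refine ContinuousLinearMap.ext fun v => ?_
    simp [hHdef]
  calc ‖fderiv ℝ (gradient f) x - H x‖
      ≤ ∑ i, |φ i x - b i| * L := by
        rw [hdiff]
        refine norm_sum_le_of_le _ fun i _ => ?_
        rw [norm_smul, Real.norm_eq_abs]
        gcongr
        exact hHessφ i x
    _ = L * ∑ i, |φ i x - b i| := by rw [← Finset.sum_mul, mul_comm]
    _ ≤ L * √(N * ∑ i, (φ i x - b i) ^ 2) := by
        gcongr
        simpa using sum_abs_le_sqrt_card_mul_sum_sq fun i => φ i x - b i
    _ = L * √(2 * N * f x) := by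
        rw [hfdef]
        ring_nf
end
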